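/- (Sharp function estimate, Lipschitz case.) Let 0 < β ≤ 1 and 0 ≤ δ < n with β + δ < n, let T and T^A be as in the context, assume T is bounded from L^r(R^n) to L^s(R^n) for every 1 < r < n/δ with 1/s = 1/r − δ/n, and suppose D^α A ∈ Lip_β(R^n) for every multi-index α with |α| = m. Then for every 1 ≤ r < n/(β + δ) there is a constant C such that for all bounded compactly supported f and all x̃ ∈ R^n, (T^A f)^♯(x̃) ≤ C Σ_{|α| = m} ‖D^α A‖_{Lip_β} (M_{β+δ,1}(f)(x̃) + M_{β+δ,r}(f)(x̃)). -/

import Mathlib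

open MeasureTheory ENNReal

noncomputable section

/-- Euclidean space `ℝⁿ`. -/
abbrev En (n : ℕ) := EuclideanSpace ℝ (Fin n)

/-- The closed cube with center `c` and side length `s`, sides parallel to the axes. -/
def cube {n : ℕ} (c : En n) (s : ℝ) : Set (En n) := {y : En n | ∀ i, |y i - c i| ≤ s / 2}

/-- The average of `b` over the cube `Q(c, s)`. -/
def cubeAvg {n : ℕ} (b : En n → ℝ) (c : En n) (s : ℝ) : ℝ :=
  (volume (cube c s)).toReal⁻¹ * ∫ y in cube c s, b y

/-- `B` is an upper bound for the BMO norm of `b`. -/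
def BMOBound {n : ℕ} (b : En n → ℝ) (B : ℝ) : Prop :=
  ∀ (c : En n) (s : ℝ), 0 < s →
    ∫ y in cube c s, |b y - cubeAvg b c s| ≤ B * (volume (cube c s)).toReal

/-- `B` is an admissible `BMO_φ` constant for `b`:
`|Q(c,s)|⁻¹ ∫_{Q(c,s)} |b − b_Q| ≤ B φ(s)` for every cube. -/
def BMOphiBound {n : ℕ} (φ : ℝ → ℝ) (b : En n → ℝ) (B : ℝ) : Prop :=
  ∀ (c : En n) (s : ℝ), 0 < s →
    ∫ y in cube c s, |b y - cubeAvg b c s| ≤ B * φ s * (volume (cube c s)).toReal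

/-- `L` is an upper bound for the `Lip_β` seminorm of `b`. -/
def LipBound {n : ℕ} (β : ℝ) (b : En n → ℝ) (L : ℝ) : Prop :=
  ∀ x y : En n, |b x - b y| ≤ L * ‖x - y‖ ^ β

/-- First-order partial derivative in the `i`-th coordinate direction. -/
def pderivFun {n : ℕ} (i : Fin n) (f : En n → ℝ) : En n → ℝ :=
  fun x => fderiv ℝ f x (EuclideanSpace.single i 1)

/-- Iterated partial derivative `D^α f` for a multi-index `α`. -/
def iterPDeriv {n : ℕ} (α : Fin n → ℕ) (f : En n → ℝ) : En n → ℝ :=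
  ((List.finRange n).foldr (fun i g => (pderivFun i)^[α i] ∘ g) id) f

/-- `g` is the distributional (weak) derivative `D^α A`. -/
def IsWeakDeriv {n : ℕ} (α : Fin n → ℕ) (A g : En n → ℝ) : Prop :=
  ∀ φ : En n → ℝ, ContDiff ℝ (⊤ : ℕ∞) φ → HasCompactSupport φ →
    ∫ x, A x * iterPDeriv α φ x = (-1 : ℝ) ^ (∑ i, α i) * ∫ x, g x * φ x

/-- The Taylor remainder `R_m(A; x, y) = A(x) − ∑_{|α| ≤ m−1} (1/α!) D^α A(y) (x−y)^α`,
where `DA α` denotes `D^α A`. -/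
def Rm {n : ℕ} (m : ℕ) (A : En n → ℝ) (DA : (Fin n → ℕ) → En n → ℝ) (x y : En n) : ℝ :=
  A x - ∑ k ∈ Finset.range m, ∑ α ∈ Finset.Nat.antidiagonalTuple n k,
    ((∏ i, Nat.factorial (α i) : ℕ) : ℝ)⁻¹ * DA α y * ∏ i, (x i - y i) ^ α i

/-- The multilinear operator `T^A f(x) = ∫ (R_{m+1}(A;x,y)/|x−y|^m) K(x,y) f(y) dy`. -/
def TA {n : ℕ} (m : ℕ) (A : En n → ℝ) (DA : (Fin n → ℕ) → En n → ℝ)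
    (K : En n → En n → ℝ) (f : En n → ℝ) (x : En n) : ℝ :=
  ∫ y, Rm (m + 1) A DA x y / ‖x - y‖ ^ m * (K x y * f y)

/-- The integral operator `T f(x) = ∫ K(x,y) f(y) dy`. -/
def Tint {n : ℕ} (K : En n → En n → ℝ) (f : En n → ℝ) (x : En n) : ℝ := ∫ y, K x y * f y

/-- A bounded, measurable, compactly supported function. -/
def NiceFun {n : ℕ} (f : En n → ℝ) : Prop :=
  Measurable f ∧ HasCompactSupport f ∧ ∃ M : ℝ, ∀ x, |f x| ≤ M

/-- The Orlicz "norm" `‖f‖_{L_ψ} = inf_{λ>0} λ⁻¹ (1 + ∫ ψ(λ|f|))`. -/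
def orliczNorm {n : ℕ} (ψ : ℝ → ℝ) (f : En n → ℝ) : ℝ≥0∞ :=
  ⨅ (l : ℝ) (_ : 0 < l),
    ENNReal.ofReal l⁻¹ * (1 + ∫⁻ x, ENNReal.ofReal (ψ (l * |f x|)))

/-- The fractional maximal function
`M_{δ,r} f(x) = sup_{Q ∋ x} (|Q|^{−(1−rδ/n)} ∫_Q |f|^r)^{1/r}`. -/
def Mfrac {n : ℕ} (δ r : ℝ) (f : En n → ℝ) (x : En n) : ℝ≥0∞ :=
  ⨆ (c : En n) (s : ℝ) (_ : 0 < s ∧ x ∈ cube c s),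
    (((volume (cube c s)) ^ (1 - r * δ / n))⁻¹ *
      ∫⁻ y in cube c s, (ENNReal.ofReal |f y|) ^ r) ^ (1 / r)

/-- The sharp maximal function `g♯(x) = sup_{Q ∋ x} |Q|⁻¹ ∫_Q |g − g_Q|`. -/
def sharpFn {n : ℕ} (g : En n → ℝ) (x : En n) : ℝ≥0∞ :=
  ⨆ (c : En n) (s : ℝ) (_ : 0 < s ∧ x ∈ cube c s),
    (volume (cube c s))⁻¹ * ∫⁻ y in cube c s, ENNReal.ofReal |g y - cubeAvg g c s|

/-- The distribution function `m_g(s) = |{x : |g(x)| > s}|`. -/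
def distrib {n : ℕ} (g : En n → ℝ) (s : ℝ) : ℝ≥0∞ := volume {x : En n | s < |g x|}



theorem pderivFun_contDiff {n : ℕ} (i : Fin n) {f : En n → ℝ} (hf : ContDiff ℝ (⊤ : ℕ∞) f) :
    ContDiff ℝ (⊤ : ℕ∞) (pderivFun i f) := by
  unfold pderivFun
  exact (hf.fderiv_right (m := (⊤ : ℕ∞)) (by simp)).clm_apply contDiff_const

theorem pderivFun_iter_contDiff {n : ℕ} (i : Fin n) (k : ℕ) {f : En n → ℝ}
    (hf : ContDiff ℝ (⊤ : ℕ∞) f) : ContDiff ℝ (⊤ : ℕ∞) ((pderivFun i)^[k] f) := by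
  induction k with
  | zero => exact hf
  | succ k ih => rw [Function.iterate_succ_apply']; exact pderivFun_contDiff i ih

theorem pderivFun_comm {n : ℕ} (i j : Fin n) {f : En n → ℝ} (hf : ContDiff ℝ (⊤ : ℕ∞) f) :
    pderivFun i (pderivFun j f) = pderivFun j (pderivFun i f) := by
  have hd : Differentiable ℝ (fderiv ℝ f) :=
    (hf.fderiv_right (m := (⊤ : ℕ∞)) (by simp)).differentiable (by simp)
  funext x
  have hs : IsSymmSndFDerivAt ℝ f x :=
    hf.contDiffAt.isSymmSndFDerivAt (by simp; exact WithTop.coe_le_coe.2 le_top)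
  have key : ∀ i j : Fin n, pderivFun i (pderivFun j f) x =
      fderiv ℝ (fderiv ℝ f) x (EuclideanSpace.single i 1) (EuclideanSpace.single j 1) := by
    intro i j
    unfold pderivFun
    rw [fderiv_clm_apply (hd x) (differentiableAt_const _)]
    simp
  rw [key, key]
  exact hs _ _

theorem pderivFun_iter_comm {n : ℕ} (i j : Fin n) (k : ℕ) {f : En n → ℝ}
    (hf : ContDiff ℝ (⊤ : ℕ∞) f) :
    (pderivFun i)^[k] (pderivFun j f) = pderivFun j ((pderivFun i)^[k] f) := by
  induction k with
  | zero => rfl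
  | succ k ih =>
    rw [Function.iterate_succ_apply', ih, Function.iterate_succ_apply',
      pderivFun_comm _ _ (pderivFun_iter_contDiff i k hf)]

/-- Partial version of `iterPDeriv` along a list. -/
def foldPD {n : ℕ} (l : List (Fin n)) (α : Fin n → ℕ) (f : En n → ℝ) : En n → ℝ :=
  (l.foldr (fun i g => (pderivFun i)^[α i] ∘ g) id) f

theorem foldPD_cons {n : ℕ} (a : Fin n) (l : List (Fin n)) (α : Fin n → ℕ) (f : En n → ℝ) :
    foldPD (a :: l) α f = (pderivFun a)^[α a] (foldPD l α f) := rfl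

theorem foldPD_contDiff {n : ℕ} (l : List (Fin n)) (α : Fin n → ℕ) {f : En n → ℝ}
    (hf : ContDiff ℝ (⊤ : ℕ∞) f) : ContDiff ℝ (⊤ : ℕ∞) (foldPD l α f) := by
  induction l with
  | nil => exact hf
  | cons a l ih => rw [foldPD_cons]; exact pderivFun_iter_contDiff a _ ih

theorem foldPD_comm {n : ℕ} (l : List (Fin n)) (α : Fin n → ℕ) (i : Fin n) {f : En n → ℝ}
    (hf : ContDiff ℝ (⊤ : ℕ∞) f) :
    foldPD l α (pderivFun i f) = pderivFun i (foldPD l α f) := by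
  induction l with
  | nil => rfl
  | cons a l ih =>
    rw [foldPD_cons, ih, pderivFun_iter_comm _ _ _ (foldPD_contDiff l α hf), foldPD_cons]

theorem foldPD_add_notMem {n : ℕ} (l : List (Fin n)) (α : Fin n → ℕ) (i : Fin n) (f : En n → ℝ)
    (hi : i ∉ l) : foldPD l (α + Pi.single i 1) f = foldPD l α f := by
  induction l with
  | nil => rfl
  | cons a l ih =>
    simp only [List.mem_cons, not_or] at hi
    rw [foldPD_cons, foldPD_cons, ih hi.2]
    have : (α + Pi.single i 1 : Fin n → ℕ) a = α a := by simp [Ne.symm hi.1]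
    rw [this]

theorem foldPD_add_mem {n : ℕ} (l : List (Fin n)) (hl : l.Nodup) (α : Fin n → ℕ) (i : Fin n)
    {f : En n → ℝ} (hf : ContDiff ℝ (⊤ : ℕ∞) f) (hi : i ∈ l) :
    foldPD l (α + Pi.single i 1) f = pderivFun i (foldPD l α f) := by
  induction l with
  | nil => simp at hi
  | cons a l ih =>
    rw [List.nodup_cons] at hl
    rw [foldPD_cons, foldPD_cons]
    by_cases h : i = a
    · subst h
      rw [foldPD_add_notMem l α i f hl.1]
      have : (α + Pi.single i 1 : Fin n → ℕ) i = α i + 1 := by simp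
      rw [this, Function.iterate_succ_apply']
    · have h2 : i ∈ l := by simpa [h] using hi
      have : (α + Pi.single i 1 : Fin n → ℕ) a = α a := by simp [Ne.symm h]
      rw [ih hl.2 h2, this, pderivFun_iter_comm _ _ _ (foldPD_contDiff l α hf)]

theorem iterPDeriv_add {n : ℕ} (α : Fin n → ℕ) (i : Fin n)
    {f : En n → ℝ} (hf : ContDiff ℝ (⊤ : ℕ∞) f) :
    iterPDeriv (α + Pi.single i 1) f = iterPDeriv α (pderivFun i f) := by
  have h1 := foldPD_add_mem (List.finRange n) (List.nodup_finRange n) α i hf (List.mem_finRange i)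
  rw [← foldPD_comm _ _ _ hf] at h1
  exact h1

theorem iterPDeriv_zero {n : ℕ} (f : En n → ℝ) : iterPDeriv (0 : Fin n → ℕ) f = f := by
  have : ∀ l : List (Fin n), foldPD l 0 f = f := by
    intro l
    induction l with
    | nil => rfl
    | cons a l ih => rw [foldPD_cons, ih]; rfl
  exact this _

/-- Taylor remainder derivative, algebraic identity. -/
theorem taylor_sum_shift {n : ℕ} (m : ℕ) (G : (Fin n → ℕ) → ℝ) (v : Fin n → ℝ) (i : Fin n) :
    ∑ k ∈ Finset.range (m + 1), ∑ α ∈ Finset.Nat.antidiagonalTuple n k,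
      ((∏ i, Nat.factorial (α i) : ℕ) : ℝ)⁻¹ * G α *
        ((∏ j ∈ Finset.univ.erase i, v j ^ α j) * (α i * v i ^ (α i - 1))) =
    ∑ k ∈ Finset.range m, ∑ α ∈ Finset.Nat.antidiagonalTuple n k,
      ((∏ i, Nat.factorial (α i) : ℕ) : ℝ)⁻¹ * G (α + Pi.single i 1) * ∏ j, v j ^ α j := by
  rw [Finset.sum_range_succ']
  have h0 : ∑ α ∈ Finset.Nat.antidiagonalTuple n 0,
      ((∏ i, Nat.factorial (α i) : ℕ) : ℝ)⁻¹ * G α *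
        ((∏ j ∈ Finset.univ.erase i, v j ^ α j) * (α i * v i ^ (α i - 1))) = 0 := by
    apply Finset.sum_eq_zero
    intro α hα
    rw [Finset.Nat.mem_antidiagonalTuple] at hα
    have : α i = 0 := by
      have := Finset.single_le_sum (f := α) (fun _ _ => Nat.zero_le _) (Finset.mem_univ i)
      omega
    simp [this]
  rw [h0, add_zero]
  refine Finset.sum_congr rfl fun k _ => ?_
  symm
  refine Finset.sum_of_injOn (fun α => α + Pi.single i 1) ?_ ?_ ?_ ?_
  · intro a _ b _ h
    exact add_right_cancel h
  · intro α hα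
    simp only [Finset.mem_coe, Finset.Nat.mem_antidiagonalTuple] at hα ⊢
    simp [Finset.sum_add_distrib, hα]
  · intro α hα hn
    have : α i = 0 := by
      by_contra h
      apply hn
      refine ⟨α - Pi.single i 1, ?_, ?_⟩
      · simp only [Finset.mem_coe, Finset.Nat.mem_antidiagonalTuple] at hα ⊢
        have h2 : (α - Pi.single i 1) + Pi.single i 1 = α := by
          funext j
          by_cases hj : j = i
          · subst hj; simp; omega
          · simp [hj]
        have h3 : ∑ j, ((α - Pi.single i 1) + Pi.single i 1 : Fin n → ℕ) j = k + 1 := by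
          rw [h2, hα]
        simp only [Pi.add_apply, Finset.sum_add_distrib, Finset.sum_pi_single', Finset.mem_univ, if_true] at h3
        omega
      · funext j
        by_cases hj : j = i
        · subst hj; simp; omega
        · simp [hj]
    simp [this]
  · intro α _
    have e1 : ∏ j ∈ Finset.univ.erase i, v j ^ (α + Pi.single i 1 : Fin n → ℕ) j =
        ∏ j ∈ Finset.univ.erase i, v j ^ α j := by
      refine Finset.prod_congr rfl fun j hj => ?_
      simp [Finset.ne_of_mem_erase hj]
    have e2 : (∏ j, Nat.factorial ((α + Pi.single i 1 : Fin n → ℕ) j) : ℕ) =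
        (α i + 1) * ∏ j, Nat.factorial (α j) := by
      rw [← Finset.mul_prod_erase _ _ (Finset.mem_univ i),
        ← Finset.mul_prod_erase Finset.univ (fun j => Nat.factorial (α j)) (Finset.mem_univ i)]
      have : ∏ j ∈ Finset.univ.erase i, Nat.factorial ((α + Pi.single i 1 : Fin n → ℕ) j) =
        ∏ j ∈ Finset.univ.erase i, Nat.factorial (α j) := by
        refine Finset.prod_congr rfl fun j hj => ?_
        simp [Finset.ne_of_mem_erase hj]
      rw [this]
      simp [Nat.factorial_succ, mul_assoc]
    rw [e1, e2, ← Finset.mul_prod_erase Finset.univ (fun j => v j ^ α j) (Finset.mem_univ i)]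
    have e3 : (α + Pi.single i 1 : Fin n → ℕ) i = α i + 1 := by simp
    rw [e3]
    have : ((α i : ℝ) + 1) ≠ 0 := by positivity
    push_cast
    rw [mul_inv]
    field_simp

theorem Rm_hasFDerivAt {n : ℕ} (m : ℕ) (F : (Fin n → ℕ) → En n → ℝ) (x y : En n)
    (h0 : HasFDerivAt (F 0) (∑ i, F (0 + Pi.single i 1) x • (EuclideanSpace.proj i : En n →L[ℝ] ℝ)) x) :
    HasFDerivAt (fun x => Rm (m + 1) (F 0) F x y)
      (∑ i, Rm m (F (0 + Pi.single i 1)) (fun γ => F (γ + Pi.single i 1)) x y •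
        (EuclideanSpace.proj i : En n →L[ℝ] ℝ)) x := by
  unfold Rm
  have hp : ∀ (α : Fin n → ℕ), HasFDerivAt (fun x : En n => ∏ i, (x i - y i) ^ α i)
      (∑ i, (∏ j ∈ Finset.univ.erase i, (x j - y j) ^ α j) •
        ((α i * (x i - y i) ^ (α i - 1)) • (EuclideanSpace.proj i : En n →L[ℝ] ℝ))) x := by
    intro α
    have := HasFDerivAt.finsetProd (u := Finset.univ) (g := fun (i : Fin n) (x : En n) => (x i - y i) ^ α i)
      (g' := fun i => ((α i * (x i - y i) ^ (α i - 1)) • (EuclideanSpace.proj i : En n →L[ℝ] ℝ))) (x := x) ?_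
    · exact this
    · intro i _
      have h1 : HasFDerivAt (fun x : En n => x i - y i) (EuclideanSpace.proj i : En n →L[ℝ] ℝ) x :=
        (EuclideanSpace.proj i : En n →L[ℝ] ℝ).hasFDerivAt.sub_const _
      have := h1.pow (α i)
      convert this using 1
      simp
  have hs : HasFDerivAt (fun x : En n => ∑ k ∈ Finset.range (m+1), ∑ α ∈ Finset.Nat.antidiagonalTuple n k,
    ((∏ i, Nat.factorial (α i) : ℕ) : ℝ)⁻¹ * F α y * ∏ i, (x i - y i) ^ α i)
      (∑ k ∈ Finset.range (m+1), ∑ α ∈ Finset.Nat.antidiagonalTuple n k,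
    (((∏ i, Nat.factorial (α i) : ℕ) : ℝ)⁻¹ * F α y) • (∑ i, (∏ j ∈ Finset.univ.erase i, (x j - y j) ^ α j) •
        ((α i * (x i - y i) ^ (α i - 1)) • (EuclideanSpace.proj i : En n →L[ℝ] ℝ)))) x := by
    refine HasFDerivAt.fun_sum fun k _ => HasFDerivAt.fun_sum fun α _ => ?_
    exact (hp α).const_mul _
  refine (h0.sub hs).congr_fderiv ?_
  simp only [sub_smul, Finset.sum_sub_distrib]
  congr 1
  simp_rw [fun i => (taylor_sum_shift m (fun α => F α y) (fun j => x j - y j) i).symm]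
  simp_rw [Finset.smul_sum, Finset.sum_smul, smul_smul, mul_assoc]
  symm
  rw [Finset.sum_comm]
  refine Finset.sum_congr rfl fun k _ => ?_
  rw [Finset.sum_comm]

theorem Rm_self {n : ℕ} (m : ℕ) (F : (Fin n → ℕ) → En n → ℝ) (y : En n) :
    Rm (m + 1) (F 0) F y y = 0 := by
  unfold Rm
  rw [Finset.sum_range_succ']
  have h1 : ∑ k ∈ Finset.range m, ∑ α ∈ Finset.Nat.antidiagonalTuple n (k+1),
      ((∏ i, Nat.factorial (α i) : ℕ) : ℝ)⁻¹ * F α y * ∏ i, (y i - y i) ^ α i = 0 := by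
    refine Finset.sum_eq_zero fun k _ => Finset.sum_eq_zero fun α hα => ?_
    rw [Finset.Nat.mem_antidiagonalTuple] at hα
    obtain ⟨i, hi⟩ : ∃ i, α i ≠ 0 := by
      by_contra! h
      simp [h] at hα
    have : ∏ i, (y i - y i) ^ α i = 0 :=
      Finset.prod_eq_zero (Finset.mem_univ i) (by simp [hi])
    rw [this, mul_zero]
  rw [h1, Finset.Nat.antidiagonalTuple_zero_right]
  simp

/-- The family `F` of functions behaves like a family of derivatives up to order `m`. -/
def DerivFam {n : ℕ} (m : ℕ) (F : (Fin n → ℕ) → En n → ℝ) : Prop :=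
  ∀ α, ∑ i, α i < m → ∀ x,
    HasFDerivAt (F α) (∑ i, F (α + Pi.single i 1) x • (EuclideanSpace.proj i : En n →L[ℝ] ℝ)) x

theorem DerivFam.shift {n m : ℕ} {F : (Fin n → ℕ) → En n → ℝ} (h : DerivFam (m + 1) F) (i : Fin n) :
    DerivFam m (fun γ => F (γ + Pi.single i 1)) := by
  intro α hα x
  have := h (α + Pi.single i 1) (by simp [Finset.sum_add_distrib]; omega) x
  refine this.congr_fderiv (Finset.sum_congr rfl fun j _ => ?_)
  rw [add_right_comm]

theorem mvt_aux {n m : ℕ} {β Λ : ℝ} (hβ : 0 < β) (hΛ : 0 ≤ Λ) {F : (Fin n → ℕ) → En n → ℝ}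
    (hF : DerivFam (m + 1) F) (y : En n)
    (ih : ∀ i x, |Rm (m + 1) (F (0 + Pi.single i 1)) (fun γ => F (γ + Pi.single i 1)) x y| ≤
      n ^ m * Λ * ‖x - y‖ ^ (m + β)) (D : ℝ) (x x0 : En n)
    (hx : ‖x - y‖ ≤ D) (hx0 : ‖x0 - y‖ ≤ D) :
    |Rm (m + 2) (F 0) F x y - Rm (m + 2) (F 0) F x0 y| ≤ n ^ (m + 1) * Λ * D ^ (m + β) * ‖x - x0‖ := by
  have := Convex.norm_image_sub_le_of_norm_hasFDerivWithin_le (𝕜 := ℝ) (s := Metric.closedBall y D)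
    (f := fun x => Rm (m + 2) (F 0) F x y) (x := x0) (y := x) (C := n ^ (m + 1) * Λ * D ^ (m + β))
    (fun z _ => (Rm_hasFDerivAt (m + 1) F z y (hF 0 (by simp) z)).hasFDerivWithinAt)
    ?_ (convex_closedBall y D) (by simpa [dist_eq_norm] using hx0) (by simpa [dist_eq_norm] using hx)
  · exact this
  intro z hz
  rw [Metric.mem_closedBall, dist_eq_norm] at hz
  have hD : 0 ≤ D := (norm_nonneg _).trans hz
  refine (norm_sum_le _ _).trans ?_
  have hb : ∀ i ∈ (Finset.univ : Finset (Fin n)), ‖Rm (m + 1) (F (0 + Pi.single i 1)) (fun γ => F (γ + Pi.single i 1)) z y •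
        (EuclideanSpace.proj i : En n →L[ℝ] ℝ)‖ ≤ n ^ m * Λ * D ^ (m + β) := by
    intro i _
    rw [norm_smul]
    have hp : ‖(EuclideanSpace.proj i : En n →L[ℝ] ℝ)‖ ≤ 1 := by
      refine ContinuousLinearMap.opNorm_le_bound _ zero_le_one fun v => ?_
      rw [one_mul]
      exact PiLp.norm_apply_le v i
    calc _ ≤ (n ^ m * Λ * ‖z - y‖ ^ (m + β)) * 1 := by
          gcongr
          exact ih i z
      _ ≤ _ := by rw [mul_one]; gcongr
  refine (Finset.sum_le_sum hb).trans ?_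
  simp only [Finset.sum_const, Finset.card_univ, Fintype.card_fin, nsmul_eq_mul]
  apply le_of_eq; ring

theorem taylor_bound {n : ℕ} (m : ℕ) {β Λ : ℝ} (hβ : 0 < β) (hΛ : 0 ≤ Λ)
    (F : (Fin n → ℕ) → En n → ℝ) (hF : DerivFam m F)
    (hL : ∀ α, ∑ i, α i = m → LipBound β (F α) Λ) (x y : En n) :
    |Rm (m + 1) (F 0) F x y| ≤ n ^ m * Λ * ‖x - y‖ ^ (m + β) := by
  induction m generalizing F x with
  | zero =>
    have := hL 0 (by simp) x y
    simpa [Rm, Finset.Nat.antidiagonalTuple_zero_right] using this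
  | succ m ih =>
    have h := mvt_aux hβ hΛ hF y (fun i x => ih _ (hF.shift i)
      (fun α hα => hL _ (by simp [Finset.sum_add_distrib, hα])) x) ‖x - y‖ x y le_rfl (by simp)
    rw [Rm_self, sub_zero] at h
    refine h.trans (le_of_eq ?_)
    rcases eq_or_ne (x - y) 0 with h0 | h0
    · rw [h0]; simp; right; rw [Real.zero_rpow (by positivity)]
    · push_cast
      rw [show (m : ℝ) + 1 + β = (m + β) + 1 by ring, Real.rpow_add_one (by simpa using h0)]
      ring

theorem taylor_diff {n : ℕ} (m : ℕ) {β Λ : ℝ} (hβ : 0 < β) (hΛ : 0 ≤ Λ)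
    (F : (Fin n → ℕ) → En n → ℝ) (hF : DerivFam (m + 1) F)
    (hL : ∀ α, ∑ i, α i = m + 1 → LipBound β (F α) Λ) (x x0 y : En n) (D : ℝ)
    (hx : ‖x - y‖ ≤ D) (hx0 : ‖x0 - y‖ ≤ D) :
    |Rm (m + 2) (F 0) F x y - Rm (m + 2) (F 0) F x0 y| ≤ n ^ (m + 1) * Λ * D ^ (m + β) * ‖x - x0‖ :=
  mvt_aux hβ hΛ hF y (fun i x => taylor_bound m hβ hΛ _ (hF.shift i)
      (fun α hα => hL _ (by simp [Finset.sum_add_distrib, hα])) x y) D x x0 hx hx0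



open scoped Convolution in
/-- Mollification. -/
def moll {n : ℕ} (φ : ContDiffBump (0 : En n)) (g : En n → ℝ) : En n → ℝ :=
  (φ.normed volume) ⋆[ContinuousLinearMap.lsmul ℝ ℝ, volume] g

theorem moll_apply {n : ℕ} (φ : ContDiffBump (0 : En n)) (g : En n → ℝ) (x : En n) :
    moll φ g x = ∫ y, g y * φ.normed volume (x - y) := by
  unfold moll
  rw [convolution_eq_swap]
  simp [mul_comm]

theorem moll_apply' {n : ℕ} (φ : ContDiffBump (0 : En n)) (g : En n → ℝ) (x : En n) :
    moll φ g x = ∫ t, φ.normed volume t * g (x - t) := by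
  unfold moll
  rw [convolution_def]
  simp

theorem bump_smooth {n : ℕ} (φ : ContDiffBump (0 : En n)) (x : En n) :
    ContDiff ℝ (⊤ : ℕ∞) (fun y => φ.normed volume (x - y)) :=
  (φ.contDiff_normed).comp (contDiff_const.sub contDiff_id)

theorem bump_supp {n : ℕ} (φ : ContDiffBump (0 : En n)) (x : En n) :
    HasCompactSupport (fun y => φ.normed volume (x - y)) :=
  (φ.hasCompactSupport_normed (μ := volume)).comp_homeomorph (Homeomorph.subLeft x)

theorem pderiv_supp {n : ℕ} (i : Fin n) {f : En n → ℝ} (hf : HasCompactSupport f) :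
    HasCompactSupport (pderivFun i f) := by
  unfold pderivFun
  exact (hf.fderiv ℝ).comp_left (g := fun L : En n →L[ℝ] ℝ => L (EuclideanSpace.single i 1)) (by simp)

theorem moll_hasFDerivAt {n : ℕ} (φ : ContDiffBump (0 : En n)) (A ga : En n → ℝ)
    (gb : Fin n → En n → ℝ) (α : Fin n → ℕ)
    (ha : IsWeakDeriv α A ga) (hb : ∀ i, IsWeakDeriv (α + Pi.single i 1) A (gb i))
    (hga : LocallyIntegrable ga volume) (x : En n) :
    HasFDerivAt (moll φ ga)
      (∑ i, moll φ (gb i) x • (EuclideanSpace.proj i : En n →L[ℝ] ℝ)) x := by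
  have hc := φ.hasCompactSupport_normed (μ := volume)
  have hs : ContDiff ℝ 1 (φ.normed volume) := φ.contDiff_normed
  have h := hc.hasFDerivAt_convolution_left (ContinuousLinearMap.lsmul ℝ ℝ) hs hga x
  refine h.congr_fderiv ?_
  have hex := (hc.fderiv ℝ).convolutionExists_left
    ((ContinuousLinearMap.lsmul ℝ ℝ : ℝ →L[ℝ] ℝ →L[ℝ] ℝ).precompL (En n))
    (hs.continuous_fderiv one_ne_zero) hga x
  have key : ∀ i, (convolution (fderiv ℝ (φ.normed volume)) ga
      ((ContinuousLinearMap.lsmul ℝ ℝ : ℝ →L[ℝ] ℝ →L[ℝ] ℝ).precompL (En n)) volume x)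
      (EuclideanSpace.single i 1) = moll φ (gb i) x := by
    intro i
    rw [convolution_def, ContinuousLinearMap.integral_apply hex]
    simp only [ContinuousLinearMap.precompL_apply, ContinuousLinearMap.lsmul_apply, smul_eq_mul]
    rw [← integral_sub_left_eq_self (fun t => fderiv ℝ (φ.normed volume) t (EuclideanSpace.single i 1) * ga (x - t)) volume x]
    simp only [_root_.sub_sub_cancel]
    set ψ : En n → ℝ := fun y => φ.normed volume (x - y) with hψ
    have hψs : ContDiff ℝ (⊤ : ℕ∞) ψ := bump_smooth φ x
    have hψc : HasCompactSupport ψ := bump_supp φ x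
    have hpd : ∀ y, pderivFun i ψ y = - fderiv ℝ (φ.normed volume) (x - y) (EuclideanSpace.single i 1) := by
      intro y
      unfold pderivFun
      have h1 : HasFDerivAt (fun y : En n => x - y) (-ContinuousLinearMap.id ℝ (En n)) y :=
        (hasFDerivAt_id y).const_sub x
      have h2 : HasFDerivAt (φ.normed volume) (fderiv ℝ (φ.normed volume) (x - y)) (x - y) :=
        (hs.differentiable one_ne_zero _).hasFDerivAt
      have h3 : HasFDerivAt ψ _ y := h2.comp y h1
      rw [h3.fderiv]
      simp
    have e1 := ha (pderivFun i ψ) (pderivFun_contDiff i hψs) (pderiv_supp i hψc)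
    have e2 := hb i ψ hψs hψc
    rw [iterPDeriv_add α i hψs, e1] at e2
    have e3 : ∑ j, (α + Pi.single i 1 : Fin n → ℕ) j = ∑ j, α j + 1 := by
      simp [Finset.sum_add_distrib]
    rw [e3, pow_succ, mul_assoc] at e2
    have e4 := mul_left_cancel₀ (pow_ne_zero _ (by norm_num)) e2
    rw [moll_apply]
    have e5 : ∫ y, ga y * pderivFun i ψ y = - ∫ y, fderiv ℝ (φ.normed volume) (x - y) (EuclideanSpace.single i 1) * ga y := by
      rw [← integral_neg]
      congr 1; funext y; rw [hpd]; ring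
    rw [e5] at e4
    linarith
  ext v
  have hv : v = ∑ i, v i • (EuclideanSpace.single i (1:ℝ) : En n) := by
    have := (EuclideanSpace.basisFun (Fin n) ℝ).sum_repr v
    simpa using this.symm
  conv_lhs => rw [hv]
  rw [map_sum]
  simp only [map_smul, key, sum_apply, smul_apply, smul_eq_mul]
  refine Finset.sum_congr rfl fun i _ => ?_
  rw [mul_comm]; rfl

theorem moll_lip {n : ℕ} (φ : ContDiffBump (0 : En n)) {β Λ : ℝ} {g : En n → ℝ}
    (hg : LocallyIntegrable g volume) (h : LipBound β g Λ) : LipBound β (moll φ g) Λ := by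
  intro x y
  have hInteg : ∀ x, Integrable (fun t => φ.normed volume t * g (x - t)) volume := by
    intro x
    have := (φ.hasCompactSupport_normed (μ := volume)).convolutionExists_left
      (ContinuousLinearMap.lsmul ℝ ℝ) (φ.contDiff_normed (n := 0)).continuous hg x
    simpa [ConvolutionExistsAt] using this
  rw [moll_apply', moll_apply', ← integral_sub (hInteg x) (hInteg y)]
  have hb := norm_integral_le_of_norm_le (μ := volume)
    (f := fun t => φ.normed volume t * g (x - t) - φ.normed volume t * g (y - t))
    (g := fun t => φ.normed volume t * (Λ * ‖x - y‖ ^ β)) ?_ ?_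
  · rw [integral_mul_const, φ.integral_normed, one_mul] at hb
    exact hb
  · exact φ.integrable_normed.mul_const _
  · filter_upwards with t
    rw [← mul_sub, norm_mul, Real.norm_of_nonneg (φ.nonneg_normed t)]
    gcongr
    · exact φ.nonneg_normed t
    · have := h (x - t) (y - t)
      simpa using this

/-- Full measure set of good points. -/
theorem good_points {n m : ℕ} {β Λ : ℝ} (hβ : 0 < β) (hΛ : 0 ≤ Λ)
    (A : En n → ℝ) (DA : (Fin n → ℕ) → En n → ℝ)
    (hA : LocallyIntegrable A volume)
    (hDA : ∀ α : Fin n → ℕ, (∑ i, α i) ≤ m + 1 →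
      IsWeakDeriv α A (DA α) ∧ LocallyIntegrable (DA α) volume)
    (hL : ∀ α, ∑ i, α i = m + 1 → LipBound β (DA α) Λ) :
    ∃ P : En n → Prop, (∀ᵐ x ∂volume, P x) ∧
      (∀ x y, P x → P y → |Rm (m + 2) A DA x y| ≤ n ^ (m + 1) * Λ * ‖x - y‖ ^ (m + 1 + β)) ∧
      (∀ x x0 y D, P x → P x0 → P y → ‖x - y‖ ≤ D → ‖x0 - y‖ ≤ D →
        |Rm (m + 2) A DA x y - Rm (m + 2) A DA x0 y| ≤
          n ^ (m + 1) * Λ * D ^ (m + β) * ‖x - x0‖) := by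
  let φ : ℕ → ContDiffBump (0 : En n) := fun k =>
    ⟨1 / ((k : ℝ) + 1), 2 / ((k : ℝ) + 1), by positivity, by gcongr; norm_num⟩
  have hφ : Filter.Tendsto (fun k => (φ k).rOut) Filter.atTop (nhds 0) := by
    have := (tendsto_one_div_add_atTop_nhds_zero_nat (𝕜 := ℝ)).const_mul 2
    simpa [φ, div_eq_mul_inv] using this
  have hφ' : ∀ᶠ k in Filter.atTop, (φ k).rOut ≤ 2 * (φ k).rIn := by
    filter_upwards with k
    simp [φ, div_eq_mul_inv]
  have hconv : ∀ g : En n → ℝ, LocallyIntegrable g volume → ∀ᵐ x ∂(volume : Measure (En n)),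
      Filter.Tendsto (fun k => moll (φ k) g x) Filter.atTop (nhds (g x)) := by
    intro g hg
    exact ContDiffBump.ae_convolution_tendsto_right_of_locallyIntegrable hφ hφ' hg
  let F : ℕ → (Fin n → ℕ) → En n → ℝ := fun k α => moll (φ k) (DA α)
  have hF : ∀ k, DerivFam (m + 1) (F k) := by
    intro k α hα x
    refine moll_hasFDerivAt (φ k) A (DA α) (fun i => DA (α + Pi.single i 1)) α
      (hDA α hα.le).1 (fun i => (hDA _ ?_).1) (hDA α hα.le).2 x
    simp [Finset.sum_add_distrib]; omega
  have hFL : ∀ k α, ∑ i, α i = m + 1 → LipBound β (F k α) Λ := fun k α hα =>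
    moll_lip (φ k) (hDA α hα.le).2 (hL α hα)
  have hF0 : ∀ k, F k 0 = moll (φ k) A := by
    intro k
    funext x
    have := (hDA 0 (by simp)).1 _ (bump_smooth (φ k) x) (bump_supp (φ k) x)
    rw [iterPDeriv_zero] at this
    simp only [F, moll_apply]
    simpa using this.symm
  refine ⟨fun x => Filter.Tendsto (fun k => moll (φ k) A x) Filter.atTop (nhds (A x)) ∧
    ∀ k ∈ Finset.range (m + 2), ∀ α ∈ Finset.Nat.antidiagonalTuple n k,
      Filter.Tendsto (fun k => moll (φ k) (DA α) x) Filter.atTop (nhds (DA α x)), ?_, ?_, ?_⟩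
  · refine (hconv A hA).and ?_
    rw [Finset.eventually_all]
    intro k hk
    rw [Finset.eventually_all]
    intro α hα
    rw [Finset.Nat.mem_antidiagonalTuple] at hα
    rw [Finset.mem_range] at hk
    exact hconv _ (hDA α (by omega)).2
  all_goals
    have hlim : ∀ x y, (Filter.Tendsto (fun k => moll (φ k) A x) Filter.atTop (nhds (A x))) →
        (∀ k ∈ Finset.range (m + 2), ∀ α ∈ Finset.Nat.antidiagonalTuple n k,
        Filter.Tendsto (fun k => moll (φ k) (DA α) y) Filter.atTop (nhds (DA α y))) →
        Filter.Tendsto (fun k => Rm (m + 2) (F k 0) (F k) x y) Filter.atTop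
          (nhds (Rm (m + 2) A DA x y)) := by
      intro x y hx hy
      unfold Rm
      simp only [hF0]
      refine hx.sub ?_
      refine tendsto_finsetSum _ fun k hk => tendsto_finsetSum _ fun α hα => ?_
      exact ((hy k hk α hα).const_mul _).mul_const _
  · intro x y hx hy
    refine le_of_tendsto (hlim x y hx.1 hy.2).abs (Filter.Eventually.of_forall fun k => ?_)
    have := taylor_bound (m + 1) hβ hΛ (F k) (hF k) (hFL k) x y
    push_cast at this
    exact this
  · intro x x0 y D hx hx0 hy h1 h2
    refine le_of_tendsto ((hlim x y hx.1 hy.2).sub (hlim x0 y hx0.1 hy.2)).abs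
      (Filter.Eventually.of_forall fun k => ?_)
    exact taylor_diff m hβ hΛ (F k) (hF k) (hFL k) x x0 y D h1 h2



theorem cube_eq_preimage {n : ℕ} (c : En n) (s : ℝ) :
    cube c s = (MeasurableEquiv.toLp 2 (Fin n → ℝ)).symm ⁻¹'
      (Set.Icc (fun i => c i - s / 2) (fun i => c i + s / 2)) := by
  ext y
  simp only [cube, Set.mem_ofPred_eq, Set.mem_preimage, Set.mem_Icc, Pi.le_def, abs_le]
  rw [← forall_and]
  refine forall_congr' fun i => ?_
  have : (MeasurableEquiv.toLp 2 (Fin n → ℝ)).symm y i = y i := rfl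
  rw [this]
  constructor <;> rintro ⟨h1, h2⟩ <;> constructor <;> linarith

theorem measurableSet_cube {n : ℕ} (c : En n) (s : ℝ) : MeasurableSet (cube c s) := by
  rw [cube_eq_preimage]
  exact (MeasurableEquiv.toLp 2 (Fin n → ℝ)).symm.measurable measurableSet_Icc

theorem volume_cube {n : ℕ} (c : En n) (s : ℝ) : volume (cube c s) = ENNReal.ofReal s ^ n := by
  rw [cube_eq_preimage,
    (EuclideanSpace.volume_preserving_symm_measurableEquiv_toLp (Fin n)).measure_preimage
      measurableSet_Icc.nullMeasurableSet, Real.volume_Icc_pi]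
  simp

theorem norm_le_of_coord {n : ℕ} (v : En n) (t : ℝ) (h : ∀ i, |v i| ≤ t) : ‖v‖ ≤ n * t := by
  have hv : v = ∑ i, v i • (EuclideanSpace.single i (1:ℝ) : En n) := by
    have := (EuclideanSpace.basisFun (Fin n) ℝ).sum_repr v
    simpa using this.symm
  rw [hv]
  refine (norm_sum_le _ _).trans ?_
  refine (Finset.sum_le_sum (g := fun _ => t) fun i _ => ?_).trans (by simp)
  rw [norm_smul]
  simpa using h i

theorem norm_le_of_mem_cube {n : ℕ} {c y : En n} {s : ℝ} (h : y ∈ cube c s) :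
    ‖y - c‖ ≤ n * (s / 2) :=
  norm_le_of_coord _ _ fun i => by simpa using h i

theorem lt_norm_of_notMem_cube {n : ℕ} {c y : En n} {s : ℝ} (h : y ∉ cube c s) :
    s / 2 < ‖y - c‖ := by
  simp only [cube, Set.mem_ofPred_eq, not_forall, not_le] at h
  obtain ⟨i, hi⟩ := h
  refine hi.trans_le ?_
  have := PiLp.norm_apply_le (y - c) i
  simpa using this

theorem cube_mono {n : ℕ} (c : En n) {s t : ℝ} (h : s ≤ t) : cube c s ⊆ cube c t :=
  fun _ hy i => (hy i).trans (by linarith)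

theorem Mfrac_ge {n : ℕ} (hn : 0 < n) {γ : ℝ} (f : En n → ℝ) {x c : En n}
    {s : ℝ} (hs : 0 < s) (hx : x ∈ cube c s) :
    ∫⁻ y in cube c s, ENNReal.ofReal |f y| ≤ ENNReal.ofReal (s ^ (n - γ)) * Mfrac γ 1 f x := by
  have h1 : ((volume (cube c s)) ^ (1 - 1 * γ / n))⁻¹ * ∫⁻ y in cube c s, ENNReal.ofReal |f y| ≤
      Mfrac γ 1 f x := by
    unfold Mfrac
    refine le_trans (le_of_eq ?_) (le_iSup_of_le c (le_iSup_of_le s (le_iSup_of_le ⟨hs, hx⟩ le_rfl)))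
    simp
  have h2 : (volume (cube c s)) ^ (1 - 1 * γ / n) = ENNReal.ofReal (s ^ (n - γ)) := by
    rw [volume_cube, ← ENNReal.ofReal_pow hs.le, ENNReal.ofReal_rpow_of_pos (by positivity),
      ← Real.rpow_natCast, ← Real.rpow_mul hs.le]
    congr 2
    field_simp
  rw [h2] at h1
  have hpos : ENNReal.ofReal (s ^ ((n:ℝ) - γ)) ≠ 0 := by
    simp only [ne_eq, ENNReal.ofReal_eq_zero, not_le]; positivity
  calc ∫⁻ y in cube c s, ENNReal.ofReal |f y| = ENNReal.ofReal (s ^ (n - γ)) *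
        ((ENNReal.ofReal (s ^ (n - γ)))⁻¹ * ∫⁻ y in cube c s, ENNReal.ofReal |f y|) := by
        rw [← mul_assoc, ENNReal.mul_inv_cancel hpos ENNReal.ofReal_ne_top, one_mul]
    _ ≤ _ := by gcongr

theorem riesz_locInt {n : ℕ} (hn : 0 < n) {γ : ℝ} (hγ : 0 < γ) :
    LocallyIntegrable (fun x : En n => ‖x‖ ^ (γ - n)) volume := by
  refine locallyIntegrable_of_norm_le_rpow (C := 1) (α := n - γ) (by simpa using Nat.succ_le_of_lt hn)
    (by simpa using hγ) ?_ ?_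
  · filter_upwards with x
    rw [Real.norm_of_nonneg (by positivity), one_mul, neg_sub]
  · exact (by fun_prop : Measurable (fun x : En n => ‖x‖ ^ (γ - n))).aestronglyMeasurable

theorem riesz_ball {n : ℕ} (hn : 0 < n) {γ : ℝ} (hγ : 0 < γ) :
    ∃ C : ℝ, 0 ≤ C ∧ ∀ R : ℝ, 0 < R → ∀ y : En n,
      ∫⁻ x in Metric.ball y R, ENNReal.ofReal (‖x - y‖ ^ (γ - n)) ≤ ENNReal.ofReal (C * R ^ γ) := by
  refine ⟨∫ x in Metric.ball (0 : En n) 1, ‖x‖ ^ (γ - n),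
    integral_nonneg fun x => by positivity, fun R hR y => ?_⟩
  have e1 : ∫⁻ x in Metric.ball y R, ENNReal.ofReal (‖x - y‖ ^ (γ - n)) =
      ∫⁻ x in Metric.ball (0 : En n) R, ENNReal.ofReal (‖x‖ ^ (γ - n)) := by
    rw [← lintegral_indicator measurableSet_ball, ← lintegral_indicator measurableSet_ball,
      ← lintegral_add_right_eq_self _ y]
    congr 1; funext x
    simp only [Set.indicator, Metric.mem_ball, dist_eq_norm, sub_zero, add_sub_cancel_right]
  have hInteg : IntegrableOn (fun x : En n => ‖x‖ ^ (γ - n)) (Metric.ball 0 R) volume :=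
    ((riesz_locInt hn hγ).integrableOn_isCompact (isCompact_closedBall 0 R)).mono_set
      Metric.ball_subset_closedBall
  rw [e1, ← ofReal_integral_eq_lintegral_ofReal hInteg (Filter.Eventually.of_forall fun x => by
    simp only [Pi.zero_apply]; positivity)]
  apply ENNReal.ofReal_le_ofReal
  have h := Measure.setIntegral_comp_smul_of_pos (volume : Measure (En n)) (fun x : En n => ‖x‖ ^ (γ - n))
    (Metric.ball 0 1) hR
  rw [_root_.smul_ball hR.ne'] at h
  simp only [smul_zero, mul_one, Real.norm_of_nonneg hR.le, norm_smul, finrank_euclideanSpace,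
    Fintype.card_fin, smul_eq_mul] at h
  simp_rw [Real.mul_rpow hR.le (norm_nonneg _)] at h
  rw [integral_const_mul, eq_inv_mul_iff_mul_eq₀ (by positivity)] at h
  rw [← h, ← mul_assoc, ← Real.rpow_natCast, ← Real.rpow_add hR]
  apply le_of_eq
  rw [mul_comm]; congr 2; ring

theorem riesz_cube {n : ℕ} (hn : 0 < n) {γ : ℝ} (hγ : 0 < γ) {N : ℝ} (hN : 1 ≤ N) :
    ∃ C : ℝ, 0 ≤ C ∧ ∀ (c : En n) (s : ℝ), 0 < s → ∀ y ∈ cube c (N * s),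
      ∫⁻ x in cube c s, ENNReal.ofReal (‖x - y‖ ^ (γ - n)) ≤ ENNReal.ofReal (C * s ^ γ) := by
  obtain ⟨C, hC, h⟩ := riesz_ball hn hγ
  refine ⟨C * (2 * n * N) ^ γ, by positivity, fun c s hs y hy => ?_⟩
  have hn' : (0:ℝ) < n := by exact_mod_cast hn
  have hsub : cube c s ⊆ Metric.ball y (2 * n * N * s) := by
    intro x hx
    rw [Metric.mem_ball, dist_eq_norm]
    have h1 := norm_le_of_mem_cube hx
    have h2 := norm_le_of_mem_cube hy
    have h3 : ‖x - y‖ ≤ ‖x - c‖ + ‖y - c‖ := by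
      rw [← norm_neg (y - c)]
      calc ‖x - y‖ = ‖(x - c) + -(y - c)‖ := by congr 1; abel
        _ ≤ _ := norm_add_le _ _
    have h4 : s ≤ N * s := by nlinarith
    have h5 : n * (s / 2) ≤ n * (N * s / 2) := by gcongr
    have h6 : 0 < n * (N * s) := by positivity
    nlinarith
  refine (lintegral_mono_set hsub).trans ((h _ (by positivity) y).trans (le_of_eq ?_))
  rw [Real.mul_rpow (by positivity) hs.le]
  congr 1; ring

theorem far_bound {n : ℕ} (hn : 0 < n) {γ η N : ℝ} (hγ : γ < n) (hη : 0 < η) (hN : 1 ≤ N) :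
    ∃ C : ℝ, 0 ≤ C ∧ ∀ (f : En n → ℝ) (x c : En n) (s : ℝ), 0 < s → x ∈ cube c s →
      ∫⁻ y in (cube c (N * s))ᶜ, ENNReal.ofReal (s ^ η * ‖y - c‖ ^ (γ - n - η)) * ENNReal.ofReal |f y| ≤
        ENNReal.ofReal C * Mfrac γ 1 f x := by
  have hq0 : (0:ℝ) ≤ 2 ^ (-η) := by positivity
  have hq1 : (2:ℝ) ^ (-η) < 1 := Real.rpow_lt_one_of_one_lt_of_neg (by norm_num) (by linarith)
  have hsum := summable_geometric_of_lt_one hq0 hq1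
  set B : ℝ := 4 ^ ((n:ℝ) - γ) * (N / 2) ^ (-η) with hB
  have hN0 : 0 < N := by linarith
  have hB0 : 0 ≤ B := by positivity
  refine ⟨∑' k : ℕ, B * ((2:ℝ) ^ (-η)) ^ k, tsum_nonneg fun k => by positivity, ?_⟩
  intro f x c s hs hx
  have hsub : (cube c (N * s))ᶜ ⊆ ⋃ k : ℕ, cube c (2 ^ (k + 1) * (N * s)) \ cube c (2 ^ k * (N * s)) := by
    intro y hy
    have hex : ∃ k : ℕ, y ∈ cube c (2 ^ k * (N * s)) := by
      obtain ⟨k, hk⟩ := pow_unbounded_of_one_lt (2 * ‖y - c‖ / (N * s)) (one_lt_two : (1:ℝ) < 2)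
      refine ⟨k, ?_⟩
      by_contra hcon
      have := lt_norm_of_notMem_cube hcon
      rw [div_lt_iff₀ (by positivity)] at hk
      linarith
    classical
    have hsp := Nat.find_spec hex
    have h0 : Nat.find hex ≠ 0 := by
      intro h0
      rw [h0] at hsp
      apply hy
      simpa using hsp
    obtain ⟨k, hk⟩ := Nat.exists_eq_succ_of_ne_zero h0
    have hmin : y ∉ cube c (2 ^ k * (N * s)) := Nat.find_min hex (by omega)
    rw [hk] at hsp
    exact Set.mem_iUnion.2 ⟨k, hsp, hmin⟩
  refine (lintegral_mono_set hsub).trans ((lintegral_iUnion_le _ _).trans ?_)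
  rw [ENNReal.ofReal_tsum_of_nonneg (fun k => by positivity) (hsum.mul_left B), ← ENNReal.tsum_mul_right]
  refine ENNReal.tsum_le_tsum fun k => ?_
  have hk0 : 0 < (2:ℝ) ^ k * (N * s) := by positivity
  calc ∫⁻ y in cube c (2 ^ (k + 1) * (N * s)) \ cube c (2 ^ k * (N * s)),
        ENNReal.ofReal (s ^ η * ‖y - c‖ ^ (γ - n - η)) * ENNReal.ofReal |f y|
      ≤ ∫⁻ y in cube c (2 ^ (k + 1) * (N * s)) \ cube c (2 ^ k * (N * s)),
        ENNReal.ofReal (s ^ η * (2 ^ k * (N * s) / 2) ^ (γ - n - η)) * ENNReal.ofReal |f y| := by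
        refine setLIntegral_mono' ((measurableSet_cube _ _).diff (measurableSet_cube _ _)) fun y hy => ?_
        gcongr ENNReal.ofReal (_ * ?_) * _
        exact Real.rpow_le_rpow_of_nonpos (by positivity) (lt_norm_of_notMem_cube hy.2).le (by linarith)
    _ = ENNReal.ofReal (s ^ η * (2 ^ k * (N * s) / 2) ^ (γ - n - η)) *
        ∫⁻ y in cube c (2 ^ (k + 1) * (N * s)) \ cube c (2 ^ k * (N * s)), ENNReal.ofReal |f y| := by
        rw [lintegral_const_mul' _ _ ENNReal.ofReal_ne_top]
    _ ≤ ENNReal.ofReal (s ^ η * (2 ^ k * (N * s) / 2) ^ (γ - n - η)) *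
        (ENNReal.ofReal ((2 ^ (k + 1) * (N * s)) ^ (n - γ)) * Mfrac γ 1 f x) := by
        gcongr
        refine (lintegral_mono_set Set.sdiff_subset).trans (Mfrac_ge hn f (by positivity) ?_)
        refine cube_mono c ?_ hx
        have : (1:ℝ) ≤ 2 ^ (k + 1) := one_le_pow₀ (by norm_num)
        have h3 : s ≤ N * s := by nlinarith
        nlinarith
    _ = ENNReal.ofReal (B * ((2:ℝ) ^ (-η)) ^ k) * Mfrac γ 1 f x := by
        rw [← mul_assoc, ← ENNReal.ofReal_mul (by positivity)]
        congr 2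
        set t : ℝ := 2 ^ k * (N * s) / 2 with ht
        have ht0 : 0 < t := by positivity
        have e1 : (2:ℝ) ^ (k + 1) * (N * s) = 4 * t := by rw [ht, pow_succ]; ring
        rw [e1, Real.mul_rpow (by norm_num) ht0.le, show γ - n - η = -(n - γ) + -η by ring,
          Real.rpow_add ht0, Real.rpow_neg ht0.le (n - γ)]
        have e2 : t ^ (-η) = (N / 2) ^ (-η) * ((2:ℝ) ^ (-η)) ^ k * s ^ (-η) := by
          rw [← Real.rpow_natCast ((2:ℝ) ^ (-η)), ← Real.rpow_mul (by norm_num), mul_comm (-η),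
            Real.rpow_mul (by norm_num), Real.rpow_natCast, ← Real.mul_rpow (by positivity) (by positivity),
            ← Real.mul_rpow (by positivity) (by positivity)]
          congr 1; rw [ht]; ring
        rw [e2, Real.rpow_neg hs.le]
        have : t ^ ((n:ℝ) - γ) ≠ 0 := by positivity
        have : s ^ η ≠ 0 := by positivity
        rw [hB]
        field_simp

/-- Oscillation around the mean versus around any constant. -/
theorem osc_le {n : ℕ} (g : En n → ℝ) (c : En n) (s a : ℝ) (hs : 0 < s)
    (hg : IntegrableOn g (cube c s) volume) :
    ∫⁻ y in cube c s, ENNReal.ofReal |g y - cubeAvg g c s| ≤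
      2 * ∫⁻ y in cube c s, ENNReal.ofReal |g y - a| := by
  have hv0 : volume (cube c s) ≠ 0 := by
    rw [volume_cube]; simp [hs]
  have hvt : volume (cube c s) ≠ ∞ := by
    rw [volume_cube]; simp
  have : IsFiniteMeasure (volume.restrict (cube c s)) := ⟨by simpa using hvt.lt_top⟩
  have hga : Integrable (fun y => g y - a) (volume.restrict (cube c s)) :=
    hg.sub (integrable_const a)
  have havg : a - cubeAvg g c s = - ((volume (cube c s)).toReal⁻¹ * ∫ y in cube c s, (g y - a)) := by
    rw [integral_sub hg (integrable_const a)]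
    unfold cubeAvg
    simp only [integral_const, measureReal_def, Measure.restrict_apply, MeasurableSet.univ,
      Set.univ_inter, smul_eq_mul]
    have : (volume (cube c s)).toReal ≠ 0 := (ENNReal.toReal_pos hv0 hvt).ne'
    field_simp
    ring
  have hle : ENNReal.ofReal |a - cubeAvg g c s| * volume (cube c s) ≤
      ∫⁻ y in cube c s, ENNReal.ofReal |g y - a| := by
    rw [havg, abs_neg, abs_mul, abs_of_nonneg (by positivity : 0 ≤ (volume (cube c s)).toReal⁻¹)]
    have h1 : |∫ y in cube c s, (g y - a)| ≤ ∫ y in cube c s, |g y - a| := abs_integral_le_integral_abs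
    have h2 : ENNReal.ofReal (∫ y in cube c s, |g y - a|) = ∫⁻ y in cube c s, ENNReal.ofReal |g y - a| :=
      ofReal_integral_eq_lintegral_ofReal hga.abs (Filter.Eventually.of_forall fun y => abs_nonneg _)
    rw [← h2]
    conv_lhs => rw [← ENNReal.ofReal_toReal hvt]
    rw [← ENNReal.ofReal_mul (by positivity)]
    apply ENNReal.ofReal_le_ofReal
    have hp := ENNReal.toReal_pos hv0 hvt
    rw [ENNReal.toReal_ofReal hp.le]
    calc _ = |∫ y in cube c s, (g y - a)| := by field_simp
      _ ≤ _ := h1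
  calc ∫⁻ y in cube c s, ENNReal.ofReal |g y - cubeAvg g c s|
      ≤ ∫⁻ y in cube c s, (ENNReal.ofReal |g y - a| + ENNReal.ofReal |a - cubeAvg g c s|) := by
        refine lintegral_mono fun y => ?_
        rw [← ENNReal.ofReal_add (abs_nonneg _) (abs_nonneg _)]
        exact ENNReal.ofReal_le_ofReal (abs_sub_le _ _ _)
    _ = (∫⁻ y in cube c s, ENNReal.ofReal |g y - a|) + ENNReal.ofReal |a - cubeAvg g c s| * volume (cube c s) := by
        rw [lintegral_add_right _ measurable_const]
        simp
    _ ≤ _ := by rw [two_mul]; gcongr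



theorem kernel_real {m : ℕ} {β δ ν ε c CK d a h R1 R0 K1 K0 : ℝ}
    (hc : 0 ≤ c) (hCK : 0 ≤ CK) (hδν : δ < ν) (hd : 0 < d) (hh : 0 ≤ h)
    (hR : |R1 - R0| ≤ c * (2 * d) ^ (m + β) * h) (hR0 : |R0| ≤ c * d ^ (m + 1 + β))
    (hK1 : |K1| ≤ CK * a ^ (δ - ν)) (hK : |K1 - K0| ≤ CK * h ^ ε * d ^ (δ - ν - ε))
    (ha1 : d / 2 ≤ a) (ha2 : a ≤ 2 * d) (had : |a - d| ≤ h) :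
    |R1 / a ^ (m + 1) * K1 - R0 / d ^ (m + 1) * K0| ≤
      c * CK * (2 ^ (m + β) * 2 ^ (m + 1) * 2 ^ (ν - δ) + (m + 1) * 2 ^ (2 * m + 1) * 2 ^ (ν - δ) + 1) *
        (h * d ^ (β + δ - ν - 1) + h ^ ε * d ^ (β + δ - ν - ε)) := by
  have ha : 0 < a := by linarith
  set e := d ^ β with he
  set D := d ^ (δ - ν) with hD
  have he0 : 0 < e := by positivity
  have hD0 : 0 < D := by positivity
  have p1 : d ^ ((m:ℝ) + 1 + β) = d ^ (m + 1) * e := by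
    rw [Real.rpow_add hd, he]; norm_cast
  have p2 : (2 * d) ^ ((m:ℝ) + β) = 2 ^ ((m:ℝ) + β) * (d ^ m * e) := by
    rw [Real.mul_rpow (by norm_num) hd.le, Real.rpow_add hd, Real.rpow_natCast]
  have p3 : a ^ (δ - ν) ≤ 2 ^ (ν - δ) * D := by
    calc a ^ (δ - ν) ≤ (d / 2) ^ (δ - ν) :=
          Real.rpow_le_rpow_of_nonpos (by positivity) ha1 (by linarith)
      _ = 2 ^ (ν - δ) * D := by
          rw [Real.div_rpow hd.le (by norm_num), show ν - δ = -(δ - ν) by ring, Real.rpow_neg (by norm_num)]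
          rw [hD]; field_simp
  have p4 : d ^ (β + δ - ν - 1) = e * D / d := by
    rw [Real.rpow_sub_one hd.ne', show β + δ - ν = β + (δ - ν) by ring, Real.rpow_add hd]
  have p5 : d ^ (β + δ - ν - ε) = e * (d ^ (δ - ν - ε)) := by
    rw [he, ← Real.rpow_add hd]; congr 1; ring
  have hK1' : |K1| ≤ CK * (2 ^ (ν - δ) * D) := hK1.trans (by gcongr)
  have q1 : (a ^ (m + 1))⁻¹ ≤ 2 ^ (m + 1) * (d ^ (m + 1))⁻¹ := by
    calc (a ^ (m + 1))⁻¹ ≤ ((d / 2) ^ (m + 1))⁻¹ := by gcongr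
      _ = _ := by rw [div_pow, inv_div]; field_simp
  have q2 : |(a ^ (m + 1))⁻¹ - (d ^ (m + 1))⁻¹| ≤
      h * (m + 1) * 2 ^ (2 * m + 1) * (d ^ m * (d ^ (m + 1))⁻¹ * (d ^ (m + 1))⁻¹) := by
    have e1 : (a ^ (m + 1))⁻¹ - (d ^ (m + 1))⁻¹ =
        (d ^ (m + 1) - a ^ (m + 1)) * ((a ^ (m + 1))⁻¹ * (d ^ (m + 1))⁻¹) := by
      field_simp
    rw [e1, abs_mul, abs_of_nonneg (by positivity : 0 ≤ (a ^ (m + 1))⁻¹ * (d ^ (m + 1))⁻¹)]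
    have e2 : |d ^ (m + 1) - a ^ (m + 1)| ≤ h * (m + 1) * (2 * d) ^ m := by
      have := abs_pow_sub_pow_le d a (m + 1)
      rw [abs_sub_comm d a, abs_of_pos hd, abs_of_pos ha] at this
      push_cast at this
      refine this.trans ?_
      gcongr
      exact max_le (by linarith) ha2
    calc _ ≤ (h * (m + 1) * (2 * d) ^ m) * ((2 ^ (m + 1) * (d ^ (m + 1))⁻¹) * (d ^ (m + 1))⁻¹) := by
          gcongr
      _ = _ := by rw [mul_pow]; ring
  have split : R1 / a ^ (m + 1) * K1 - R0 / d ^ (m + 1) * K0 =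
      (R1 - R0) * (a ^ (m + 1))⁻¹ * K1 + R0 * ((a ^ (m + 1))⁻¹ - (d ^ (m + 1))⁻¹) * K1 +
        R0 * (d ^ (m + 1))⁻¹ * (K1 - K0) := by
    rw [div_eq_mul_inv, div_eq_mul_inv]; ring
  rw [p2] at hR
  rw [p1] at hR0
  have t1 : |(R1 - R0) * (a ^ (m + 1))⁻¹ * K1| ≤
      c * CK * (2 ^ (m + β) * 2 ^ (m + 1) * 2 ^ (ν - δ)) * (h * (e * D / d)) := by
    rw [abs_mul, abs_mul, abs_of_nonneg (by positivity : 0 ≤ (a ^ (m + 1))⁻¹)]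
    calc _ ≤ (c * (2 ^ ((m:ℝ) + β) * (d ^ m * e)) * h) * (2 ^ (m + 1) * (d ^ (m + 1))⁻¹) *
          (CK * (2 ^ (ν - δ) * D)) := by gcongr
      _ = _ := by rw [pow_succ d]; field_simp
  have t2 : |R0 * ((a ^ (m + 1))⁻¹ - (d ^ (m + 1))⁻¹) * K1| ≤
      c * CK * ((m + 1) * 2 ^ (2 * m + 1) * 2 ^ (ν - δ)) * (h * (e * D / d)) := by
    rw [abs_mul, abs_mul]
    calc _ ≤ (c * (d ^ (m + 1) * e)) *
          (h * (m + 1) * 2 ^ (2 * m + 1) * (d ^ m * (d ^ (m + 1))⁻¹ * (d ^ (m + 1))⁻¹)) *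
          (CK * (2 ^ (ν - δ) * D)) := by gcongr
      _ = _ := by rw [pow_succ d]; field_simp
  have t3 : |R0 * (d ^ (m + 1))⁻¹ * (K1 - K0)| ≤
      c * CK * (h ^ ε * (e * d ^ (δ - ν - ε))) := by
    rw [abs_mul, abs_mul, abs_of_nonneg (by positivity : 0 ≤ (d ^ (m + 1))⁻¹)]
    calc _ ≤ (c * (d ^ (m + 1) * e)) * (d ^ (m + 1))⁻¹ * (CK * h ^ ε * d ^ (δ - ν - ε)) := by gcongr
      _ = _ := by field_simp
  rw [split, p4, p5]
  refine (abs_add_three _ _ _).trans ((add_le_add (add_le_add t1 t2) t3).trans ?_)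
  set a1 : ℝ := 2 ^ ((m:ℝ) + β) * 2 ^ (m + 1) * 2 ^ (ν - δ) with ha1'
  set a2 : ℝ := (m + 1) * 2 ^ (2 * m + 1) * 2 ^ (ν - δ) with ha2'
  set X := h * (e * D / d) with hX
  set Y := h ^ ε * (e * d ^ (δ - ν - ε)) with hY
  have : 0 ≤ X := by positivity
  have : 0 ≤ Y := by positivity
  have : 0 ≤ a1 := by positivity
  have : 0 ≤ a2 := by positivity
  have : 0 ≤ c * CK * (X + (a1 + a2) * Y) := by positivity
  linarith

theorem kernel_size {m : ℕ} {β δ ν c CK d R K : ℝ} (hm : 0 ≤ β)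
    (hc : 0 ≤ c) (hCK : 0 ≤ CK) (hd0 : 0 ≤ d)
    (hR0 : |R| ≤ c * d ^ (m + 1 + β))
    (hK1 : d ≠ 0 → |K| ≤ CK * d ^ (δ - ν)) :
    |R / d ^ (m + 1) * K| ≤ c * CK * d ^ (β + δ - ν) := by
  rcases hd0.eq_or_lt with h | hd
  · subst h
    simp
    positivity
  have p1 : d ^ ((m:ℝ) + 1 + β) = d ^ (m + 1) * d ^ β := by
    rw [Real.rpow_add hd]; norm_cast
  rw [p1] at hR0
  rw [abs_mul, abs_div, abs_of_pos (by positivity : 0 < d ^ (m + 1)),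
    show β + δ - ν = β + (δ - ν) by ring, Real.rpow_add hd]
  calc _ ≤ (c * (d ^ (m + 1) * d ^ β)) / d ^ (m + 1) * (CK * d ^ (δ - ν)) := by
        gcongr; exact hK1 hd.ne'
    _ = _ := by field_simp

theorem Rm_aesm_prod {n m : ℕ} (A : En n → ℝ) (DA : (Fin n → ℕ) → En n → ℝ)
    (hA : AEStronglyMeasurable A volume)
    (hDA : ∀ α : Fin n → ℕ, (∑ i, α i) ≤ m → AEStronglyMeasurable (DA α) volume) :
    AEStronglyMeasurable (fun p : En n × En n => Rm (m + 1) A DA p.1 p.2)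
      ((volume : Measure (En n)).prod volume) := by
  unfold Rm
  refine (hA.comp_fst).sub ?_
  refine Finset.aestronglyMeasurable_fun_sum _ fun k hk => Finset.aestronglyMeasurable_fun_sum _ fun α hα => ?_
  rw [Finset.Nat.mem_antidiagonalTuple] at hα
  rw [Finset.mem_range] at hk
  refine (((hDA α (by omega)).comp_snd).const_mul _).mul ?_
  apply Measurable.aestronglyMeasurable
  fun_prop

theorem Rm_aesm_snd {n m : ℕ} (A : En n → ℝ) (DA : (Fin n → ℕ) → En n → ℝ)
    (hDA : ∀ α : Fin n → ℕ, (∑ i, α i) ≤ m → AEStronglyMeasurable (DA α) volume) (x : En n) :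
    AEStronglyMeasurable (fun y : En n => Rm (m + 1) A DA x y) volume := by
  unfold Rm
  refine aestronglyMeasurable_const.sub ?_
  refine Finset.aestronglyMeasurable_fun_sum _ fun k hk => Finset.aestronglyMeasurable_fun_sum _ fun α hα => ?_
  rw [Finset.Nat.mem_antidiagonalTuple] at hα
  rw [Finset.mem_range] at hk
  refine ((hDA α (by omega)).const_mul _).mul ?_
  apply Measurable.aestronglyMeasurable
  fun_prop

theorem TA_aesm {n m : ℕ} (A : En n → ℝ) (DA : (Fin n → ℕ) → En n → ℝ)
    (hA : AEStronglyMeasurable A volume)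
    (hDA : ∀ α : Fin n → ℕ, (∑ i, α i) ≤ m → AEStronglyMeasurable (DA α) volume)
    (K : En n → En n → ℝ) (hK : Measurable (Function.uncurry K)) (f : En n → ℝ) (hf : Measurable f) :
    AEStronglyMeasurable (TA m A DA K f) volume := by
  have h1 : AEStronglyMeasurable (fun p : En n × En n => Rm (m + 1) A DA p.1 p.2 / ‖p.1 - p.2‖ ^ m *
      (K p.1 p.2 * f p.2)) ((volume : Measure (En n)).prod volume) := by
    simp_rw [div_eq_mul_inv]
    refine ((Rm_aesm_prod A DA hA hDA).mul ?_).mul ?_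
    · exact (by fun_prop : Measurable (fun p : En n × En n => (‖p.1 - p.2‖ ^ m)⁻¹)).aestronglyMeasurable
    · exact (hK.mul (hf.comp measurable_snd)).aestronglyMeasurable
  exact h1.integral_prod_right'

theorem ker_aesm {n m : ℕ} (A : En n → ℝ) (DA : (Fin n → ℕ) → En n → ℝ)
    (hDA : ∀ α : Fin n → ℕ, (∑ i, α i) ≤ m → AEStronglyMeasurable (DA α) volume)
    (K : En n → En n → ℝ) (hK : Measurable (Function.uncurry K)) (f : En n → ℝ) (hf : Measurable f)
    (x : En n) :
    AEStronglyMeasurable (fun y => Rm (m + 1) A DA x y / ‖x - y‖ ^ m * (K x y * f y)) volume := by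
  simp_rw [div_eq_mul_inv]
  refine ((Rm_aesm_snd A DA hDA x).mul ?_).mul ?_
  · exact (by fun_prop : Measurable (fun y : En n => (‖x - y‖ ^ m)⁻¹)).aestronglyMeasurable
  · have : Measurable (fun y => K x y) := hK.comp measurable_prodMk_left
    exact (this.mul hf).aestronglyMeasurable

theorem riesz_integrable {n : ℕ} (hn : 0 < n) {γ : ℝ} (hγ : 0 < γ) (f : En n → ℝ) (hf : NiceFun f)
    (x : En n) : Integrable (fun y => ‖x - y‖ ^ (γ - n) * |f y|) volume := by
  obtain ⟨hfm, hfc, M, hM⟩ := hf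
  have hM0 : 0 ≤ M := (abs_nonneg _).trans (hM 0)
  have h1 : IntegrableOn (fun y : En n => ‖y‖ ^ (γ - n)) ((fun y => x - y) '' tsupport f) volume :=
    (riesz_locInt hn hγ).integrableOn_isCompact (hfc.isCompact.image (by fun_prop))
  have h2 : Integrable (fun y => ((fun y => x - y) '' tsupport f).indicator
    (fun y : En n => ‖y‖ ^ (γ - n)) (x - y)) volume :=
    ((integrable_indicator_iff (hfc.isCompact.image (by fun_prop)).measurableSet).2 h1).comp_sub_left x
  refine (h2.mul_const M).mono' ?_ ?_
  · exact (by fun_prop : Measurable (fun y => ‖x - y‖ ^ (γ - n) * |f y|)).aestronglyMeasurable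
  · filter_upwards with y
    rw [Real.norm_of_nonneg (by positivity)]
    by_cases hy : y ∈ tsupport f
    · rw [Set.indicator_of_mem (show x - y ∈ (fun y => x - y) '' tsupport f from ⟨y, hy, rfl⟩)]
      gcongr
      exact hM y
    · rw [image_eq_zero_of_notMem_tsupport hy]
      simp only [abs_zero, mul_zero]
      refine mul_nonneg (Set.indicator_nonneg (fun y _ => by positivity) _) hM0



theorem ofm {a b : ℝ} (ha : 0 ≤ a) (X : ℝ≥0∞) :
    ENNReal.ofReal a * (ENNReal.ofReal b * X) = ENNReal.ofReal (a * b) * X := by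
  rw [← mul_assoc, ENNReal.ofReal_mul ha]

theorem far_geom {n : ℕ} (hn : 0 < n) {c x x0 y : En n} {s : ℝ} (hs : 0 < s)
    (hx : x ∈ cube c s) (hx0 : x0 ∈ cube c s) (hy : y ∉ cube c (8 * n * s)) :
    ‖x - x0‖ ≤ n * s ∧ ‖y - c‖ / 2 ≤ ‖y - x0‖ ∧ 2 * ‖x - x0‖ ≤ ‖y - x0‖ ∧ 0 < ‖y - c‖ := by
  have h1 := norm_le_of_mem_cube hx
  have h2 := norm_le_of_mem_cube hx0
  have h3 := lt_norm_of_notMem_cube hy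
  have hn1 : (1:ℝ) ≤ n := by exact_mod_cast hn
  have hns : 0 < n * s := by positivity
  have h4 : ‖x - x0‖ ≤ ‖x - c‖ + ‖x0 - c‖ := by
    have := norm_sub_le (x - c) (x0 - c)
    simpa using this
  have h5 : ‖y - c‖ ≤ ‖y - x0‖ + ‖x0 - c‖ := by
    have := norm_add_le (y - x0) (x0 - c)
    simpa using this
  refine ⟨by linarith, by linarith, by linarith, by linarith⟩

theorem far_pt {γ ν η t h d ρ s : ℝ} (hη : 0 < η) (hγ : γ < ν) (ht : 0 < t)
    (hh0 : 0 ≤ h) (hs : 0 < s) (hh : h ≤ t * s) (hρ : 0 < ρ) (hd : ρ / 2 ≤ d) :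
    h ^ η * d ^ (γ - ν - η) ≤ t ^ η * 2 ^ (ν + η - γ) * (s ^ η * ρ ^ (γ - ν - η)) := by
  have h1 : h ^ η ≤ t ^ η * s ^ η := by
    rw [← Real.mul_rpow ht.le hs.le]
    exact Real.rpow_le_rpow hh0 hh hη.le
  have h2 : d ^ (γ - ν - η) ≤ 2 ^ (ν + η - γ) * ρ ^ (γ - ν - η) := by
    have := Real.rpow_le_rpow_of_nonpos (by positivity : 0 < ρ / 2) hd (by linarith : γ - ν - η ≤ 0)
    refine this.trans (le_of_eq ?_)
    rw [Real.div_rpow hρ.le (by norm_num), show ν + η - γ = -(γ - ν - η) by ring,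
      Real.rpow_neg (by norm_num)]
    field_simp
  have hd0 : 0 ≤ d := by linarith
  calc _ ≤ (t ^ η * s ^ η) * (2 ^ (ν + η - γ) * ρ ^ (γ - ν - η)) := by gcongr
    _ = _ := by ring

theorem near_bound {n : ℕ} (hn : 0 < n) {γ : ℝ} (hγ : 0 < γ) (hγn : γ < n) {N : ℝ} (hN : 1 ≤ N) :
    ∃ C : ℝ, 0 ≤ C ∧ ∀ (κ : ℝ), 0 ≤ κ → ∀ (f : En n → ℝ), Measurable f → ∀ (xt c : En n) (s : ℝ),
      0 < s → xt ∈ cube c s →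
      ∫⁻ x in cube c s, ∫⁻ y in cube c (N * s),
        ENNReal.ofReal (κ * ‖x - y‖ ^ (γ - n)) * ENNReal.ofReal |f y| ≤
      volume (cube c s) * (ENNReal.ofReal (κ * C) * Mfrac γ 1 f xt) := by
  obtain ⟨C1, hC1, H1⟩ := riesz_cube hn hγ hN
  refine ⟨C1 * N ^ (n - γ), by positivity, fun κ hκ f hf xt c s hs hx => ?_⟩
  have hN0 : 0 < N := by linarith
  rw [lintegral_lintegral_swap (by
    apply Measurable.aemeasurable
    unfold Function.uncurry
    fun_prop)]
  have step : ∀ y ∈ cube c (N * s), ∫⁻ x in cube c s, ENNReal.ofReal (κ * ‖x - y‖ ^ (γ - n)) *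
      ENNReal.ofReal |f y| ≤ ENNReal.ofReal (κ * (C1 * s ^ γ)) * ENNReal.ofReal |f y| := by
    intro y hy
    rw [lintegral_mul_const _ (by fun_prop)]
    gcongr
    simp_rw [ENNReal.ofReal_mul hκ]
    rw [lintegral_const_mul _ (by fun_prop)]
    gcongr
    exact H1 c s hs y hy
  calc _ ≤ ∫⁻ y in cube c (N * s), ENNReal.ofReal (κ * (C1 * s ^ γ)) * ENNReal.ofReal |f y| :=
        setLIntegral_mono' (measurableSet_cube _ _) step
    _ = ENNReal.ofReal (κ * (C1 * s ^ γ)) * ∫⁻ y in cube c (N * s), ENNReal.ofReal |f y| := by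
        rw [lintegral_const_mul _ (by fun_prop)]
    _ ≤ ENNReal.ofReal (κ * (C1 * s ^ γ)) *
          (ENNReal.ofReal ((N * s) ^ (n - γ)) * Mfrac γ 1 f xt) := by
        gcongr
        exact Mfrac_ge hn f (by positivity) (cube_mono c (by nlinarith) hx)
    _ = _ := by
        rw [volume_cube, ← ENNReal.ofReal_pow hs.le, ofm (by positivity), ofm (by positivity)]
        congr 2
        rw [Real.mul_rpow hN0.le hs.le]
        have : s ^ n = s ^ γ * s ^ ((n:ℝ) - γ) := by
          rw [← Real.rpow_add hs, add_sub_cancel, Real.rpow_natCast]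
        rw [this]; ring

theorem osc_abstract {n : ℕ} (hn : 0 < n) {γ ε : ℝ} (hγ : 0 < γ) (hγn : γ < n) (hε : 0 < ε) :
    ∃ C : ℝ, 0 ≤ C ∧ ∀ (κ : ℝ), 0 ≤ κ → ∀ (k : En n → En n → ℝ) (P : En n → Prop),
      (∀ᵐ x ∂(volume : Measure (En n)), P x) → ∀ f : En n → ℝ, NiceFun f →
      (∀ x, AEStronglyMeasurable (fun y => k x y * f y) volume) →
      AEStronglyMeasurable (fun x => ∫ y, k x y * f y) volume →
      (∀ x y, P x → P y → |k x y| ≤ κ * ‖x - y‖ ^ (γ - n)) →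
      (∀ x x0 y, P x → P x0 → P y → 2 * ‖x - x0‖ ≤ ‖y - x0‖ → 0 < ‖y - x0‖ →
        |k x y - k x0 y| ≤ κ * (‖x - x0‖ * ‖y - x0‖ ^ (γ - n - 1) +
          ‖x - x0‖ ^ ε * ‖y - x0‖ ^ (γ - n - ε))) →
      ∀ xt, sharpFn (fun x => ∫ y, k x y * f y) xt ≤ ENNReal.ofReal (C * κ) * Mfrac γ 1 f xt := by
  have hn1 : (1:ℝ) ≤ n := by exact_mod_cast hn
  have hN : (1:ℝ) ≤ 8 * n := by linarith
  obtain ⟨C1, hC1, H1⟩ := near_bound hn hγ hγn hN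
  obtain ⟨C2, hC2, H2⟩ := far_bound hn hγn (zero_lt_one (α := ℝ)) hN
  obtain ⟨C3, hC3, H3⟩ := far_bound hn hγn hε hN
  obtain ⟨E1, hE1⟩ : ∃ E1 : ℝ, E1 = (n:ℝ) ^ (1:ℝ) * 2 ^ ((n:ℝ) + 1 - γ) := ⟨_, rfl⟩
  obtain ⟨E2, hE2⟩ : ∃ E2 : ℝ, E2 = (n:ℝ) ^ ε * 2 ^ ((n:ℝ) + ε - γ) := ⟨_, rfl⟩
  have hE1p : 0 ≤ E1 := by rw [hE1]; positivity
  have hE2p : 0 ≤ E2 := by rw [hE2]; positivity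
  refine ⟨2 * (C1 + (E1 * C2 + E2 * C3)), by positivity, ?_⟩
  intro κ hκ k P hP f hf hkm hgm hsize hsm xt
  set g : En n → ℝ := fun x => ∫ y, k x y * f y with hg
  set M := Mfrac γ 1 f xt with hM
  unfold sharpFn
  refine iSup_le fun c => iSup_le fun s => iSup_le fun ⟨hs, hx⟩ => ?_
  have hvol0 : volume (cube c s) ≠ 0 := by
    rw [volume_cube]; exact pow_ne_zero n (ENNReal.ofReal_pos.2 hs).ne'
  have hvolt : volume (cube c s) ≠ ⊤ := by
    rw [volume_cube]; exact ENNReal.pow_ne_top ENNReal.ofReal_ne_top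
  -- a good point of the cube
  obtain ⟨x0, hx0, hPx0⟩ : ∃ x0, x0 ∈ cube c s ∧ P x0 := by
    by_contra! hcon
    apply hvol0
    exact measure_mono_null (fun x hx => hcon x hx) hP
  have hInteg : ∀ x, P x → Integrable (fun y => k x y * f y) volume := by
    intro x hPx
    refine ((riesz_integrable hn hγ f hf x).const_mul κ).mono' (hkm x) ?_
    filter_upwards [hP] with y hy
    rw [Real.norm_eq_abs, abs_mul, ← mul_assoc]
    gcongr
    exact hsize x y hPx hy
  set Q' := cube c (8 * n * s) with hQ'
  have hQ'm : MeasurableSet Q' := measurableSet_cube _ _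
  set a := ∫ y in Q'ᶜ, k x0 y * f y with ha
  set G := ∫⁻ y in Q'ᶜ, (ENNReal.ofReal (κ * E1) * (ENNReal.ofReal (s ^ (1:ℝ) * ‖y - c‖ ^ (γ - n - 1))
      * ENNReal.ofReal |f y|) + ENNReal.ofReal (κ * E2) *
      (ENNReal.ofReal (s ^ ε * ‖y - c‖ ^ (γ - n - ε)) * ENNReal.ofReal |f y|)) with hG
  have hfm := hf.1
  have hGle : G ≤ ENNReal.ofReal (κ * (E1 * C2 + E2 * C3)) * M := by
    rw [hG, lintegral_add_left (by fun_prop), lintegral_const_mul _ (by fun_prop),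
      lintegral_const_mul _ (by fun_prop)]
    calc _ ≤ ENNReal.ofReal (κ * E1) * (ENNReal.ofReal C2 * M) +
          ENNReal.ofReal (κ * E2) * (ENNReal.ofReal C3 * M) := by
          gcongr
          · exact H2 f xt c s hs hx
          · exact H3 f xt c s hs hx
      _ = _ := by
          rw [ofm (by positivity), ofm (by positivity), ← add_mul,
            ← ENNReal.ofReal_add (by positivity) (by positivity)]
          congr 2; ring
  have hpt : ∀ x ∈ cube c s, P x → ENNReal.ofReal |g x - a| ≤
      (∫⁻ y in Q', ENNReal.ofReal (κ * ‖x - y‖ ^ (γ - n)) * ENNReal.ofReal |f y|) + G := by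
    intro x hxQ hPx
    have e1 : g x - a = (∫ y in Q', k x y * f y) + ∫ y in Q'ᶜ, (k x y * f y - k x0 y * f y) := by
      rw [integral_sub (hInteg x hPx).integrableOn (hInteg x0 hPx0).integrableOn, hg, ha]
      simp only
      rw [← integral_add_compl hQ'm (hInteg x hPx)]
      ring
    rw [e1]
    refine (ENNReal.ofReal_le_ofReal (abs_add_le _ _)).trans ?_
    rw [ENNReal.ofReal_add (abs_nonneg _) (abs_nonneg _)]
    refine add_le_add ?_ ?_
    · rw [← Real.norm_eq_abs, ofReal_norm]
      refine (enorm_integral_le_lintegral_enorm _).trans ?_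
      refine lintegral_mono_ae ?_
      filter_upwards [ae_restrict_of_ae hP] with y hy
      rw [← ofReal_norm, Real.norm_eq_abs, abs_mul, ENNReal.ofReal_mul (abs_nonneg _)]
      gcongr
      exact hsize x y hPx hy
    · rw [← Real.norm_eq_abs, ofReal_norm]
      refine (enorm_integral_le_lintegral_enorm _).trans ?_
      refine lintegral_mono_ae ?_
      filter_upwards [ae_restrict_of_ae hP, ae_restrict_mem hQ'm.compl] with y hy hyQ
      obtain ⟨g1, g2, g3, g4⟩ := far_geom hn hs hxQ hx0 hyQ
      rw [← ofReal_norm, Real.norm_eq_abs, ← sub_mul, abs_mul, ENNReal.ofReal_mul (abs_nonneg _),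
        ofm (by positivity), ofm (by positivity), ← add_mul, ← ENNReal.ofReal_add (by positivity) (by positivity)]
      gcongr
      refine (hsm x x0 y hPx hPx0 hy g3 (by linarith)).trans ?_
      have f1 := far_pt (ν := n) (γ := γ) zero_lt_one hγn (by positivity : (0:ℝ) < n)
        (norm_nonneg (x - x0)) hs g1 g4 g2
      have f2 := far_pt (ν := n) (γ := γ) hε hγn (by positivity : (0:ℝ) < n)
        (norm_nonneg (x - x0)) hs g1 g4 g2
      rw [Real.rpow_one ‖x - x0‖] at f1
      rw [← hE1] at f1
      rw [← hE2] at f2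
      rw [mul_assoc, mul_assoc, ← mul_add]
      gcongr
  have hmain : ∫⁻ x in cube c s, ENNReal.ofReal |g x - a| ≤
      volume (cube c s) * (ENNReal.ofReal (κ * (C1 + (E1 * C2 + E2 * C3))) * M) := by
    calc _ ≤ ∫⁻ x in cube c s, ((∫⁻ y in Q', ENNReal.ofReal (κ * ‖x - y‖ ^ (γ - n)) *
            ENNReal.ofReal |f y|) + G) := by
          refine lintegral_mono_ae ?_
          filter_upwards [ae_restrict_of_ae hP, ae_restrict_mem (measurableSet_cube c s)] with x h1 h2
          exact hpt x h2 h1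
      _ = (∫⁻ x in cube c s, ∫⁻ y in Q', ENNReal.ofReal (κ * ‖x - y‖ ^ (γ - n)) *
            ENNReal.ofReal |f y|) + volume (cube c s) * G := by
          rw [lintegral_add_right _ measurable_const, setLIntegral_const, mul_comm G]
      _ ≤ volume (cube c s) * (ENNReal.ofReal (κ * C1) * M) +
          volume (cube c s) * (ENNReal.ofReal (κ * (E1 * C2 + E2 * C3)) * M) := by
          gcongr
          exact H1 κ hκ f hfm xt c s hs hx
      _ = _ := by
          rw [← mul_add, ← add_mul, ← ENNReal.ofReal_add (by positivity) (by positivity), ← mul_add]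
  set B := ENNReal.ofReal (κ * (C1 + (E1 * C2 + E2 * C3))) * M with hB
  have hfin : ENNReal.ofReal (2 * (C1 + (E1 * C2 + E2 * C3)) * κ) * M = 2 * B := by
    rw [hB, ← mul_assoc, show (2:ℝ≥0∞) = ENNReal.ofReal 2 by simp,
      ← ENNReal.ofReal_mul (by norm_num)]
    congr 2; ring
  rw [hfin]
  by_cases hBt : B = ⊤
  · rw [hBt]; simp
  have hgi : IntegrableOn g (cube c s) volume := by
    have h1 : IntegrableOn (fun x => g x - a) (cube c s) volume := by
      refine ⟨(hgm.sub aestronglyMeasurable_const).restrict, ?_⟩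
      rw [hasFiniteIntegral_iff_norm]
      exact hmain.trans_lt (ENNReal.mul_lt_top hvolt.lt_top (lt_top_iff_ne_top.2 hBt))
    have h2 : IntegrableOn (fun _ : En n => a) (cube c s) volume :=
      integrableOn_const hvolt
    have h3 := h1.add h2
    have h4 : ((fun x => g x - a) + fun _ => a) = g := by
      funext x
      simp
    rw [h4] at h3
    exact h3
  calc _ ≤ (volume (cube c s))⁻¹ * (2 * (volume (cube c s) * B)) := by
        gcongr
        exact (osc_le g c s a hs hgi).trans (by gcongr)
    _ = ((volume (cube c s))⁻¹ * volume (cube c s)) * (2 * B) := by ring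
    _ = 2 * B := by rw [ENNReal.inv_mul_cancel hvol0 hvolt, one_mul]


/-- Sharp function estimate, Lipschitz case.
`(T^A f)♯(x̃) ≤ C Σ_{|α|=m} ‖D^α A‖_{Lip_β} (M_{β+δ,1} f(x̃) + M_{β+δ,r} f(x̃))`. -/
theorem stmt16 {n m : ℕ} (hn : 0 < n) (hm : 0 < m)
    (β δ ε : ℝ) (hβ0 : 0 < β) (hβ1 : β ≤ 1) (hδ0 : 0 ≤ δ) (hδn : δ < n) (hε : 0 < ε)
    (hβδn : β + δ < n)
    (A : En n → ℝ) (DA : (Fin n → ℕ) → En n → ℝ)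
    (hA : LocallyIntegrable A volume)
    (hDA : ∀ α : Fin n → ℕ, (∑ i, α i) ≤ m →
      IsWeakDeriv α A (DA α) ∧ LocallyIntegrable (DA α) volume)
    (K : En n → En n → ℝ) (hKmeas : Measurable (Function.uncurry K)) (CK : ℝ)
    (hK1 : ∀ x y : En n, x ≠ y → |K x y| ≤ CK * ‖x - y‖ ^ (δ - n))
    (hK2 : ∀ x y z : En n, 2 * ‖y - z‖ ≤ ‖x - z‖ →
      |K y x - K z x| ≤ CK * ‖y - z‖ ^ ε * ‖x - z‖ ^ (δ - n - ε))
    -- `T` is bounded from `L^r` to `L^s` for all `1 < r < n/δ`, `1/s = 1/r − δ/n`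
    (hT : ∀ r s : ℝ, 1 < r → δ * r < n → 1 / s = 1 / r - δ / n →
      ∃ C : ℝ, ∀ f : En n → ℝ, NiceFun f →
        eLpNorm (Tint K f) (ENNReal.ofReal s) volume ≤
          ENNReal.ofReal C * eLpNorm f (ENNReal.ofReal r) volume) :
    ∀ r : ℝ, 1 ≤ r → (β + δ) * r < n →
      ∃ C : ℝ, ∀ L : (Fin n → ℕ) → ℝ,
        -- `L α` bounds the `Lip_β` norm of `D^α A` for each `|α| = m`
        (∀ α ∈ Finset.Nat.antidiagonalTuple n m, LipBound β (DA α) (L α)) →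
        ∀ f : En n → ℝ, NiceFun f → ∀ xt : En n,
          sharpFn (TA m A DA K f) xt ≤
            ENNReal.ofReal (C * ∑ α ∈ Finset.Nat.antidiagonalTuple n m, L α) *
              (Mfrac (β + δ) 1 f xt + Mfrac (β + δ) r f xt) := by
  intro r hr hγr
  obtain ⟨m, rfl⟩ : ∃ m', m = m' + 1 := ⟨m - 1, by omega⟩
  obtain ⟨C, hC, H⟩ := osc_abstract hn (γ := β + δ) (by linarith) hβδn hε
  have hne : ‖(EuclideanSpace.single (⟨0, hn⟩ : Fin n) (1:ℝ) : En n) - 0‖ = 1 := by simp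
  have hCK : 0 ≤ CK := by
    have := hK1 (EuclideanSpace.single (⟨0, hn⟩ : Fin n) (1:ℝ)) 0 (by
      intro h
      rw [h] at hne
      simp at hne)
    rw [hne, Real.one_rpow, mul_one] at this
    exact (abs_nonneg _).trans this
  obtain ⟨E, hE⟩ : ∃ E : ℝ, E = 2 ^ (m + β) * 2 ^ (m + 1) * 2 ^ (n - δ) +
    (m + 1) * 2 ^ (2 * m + 1) * 2 ^ (n - δ) + 1 := ⟨_, rfl⟩
  have hE1 : 1 ≤ E := by
    rw [hE]
    have : (0:ℝ) ≤ 2 ^ (m + β) * 2 ^ (m + 1) * 2 ^ (n - δ) +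
      (m + 1) * 2 ^ (2 * m + 1) * 2 ^ (n - δ) := by positivity
    linarith
  refine ⟨C * (n ^ (m + 1) * CK * E), fun L hL f hf xt => ?_⟩
  have hL0 : ∀ α ∈ Finset.Nat.antidiagonalTuple n (m + 1), 0 ≤ L α := by
    intro α hα
    have := hL α hα (EuclideanSpace.single (⟨0, hn⟩ : Fin n) (1:ℝ)) 0
    rw [hne, Real.one_rpow, mul_one] at this
    exact (abs_nonneg _).trans this
  obtain ⟨Λ, hΛ⟩ : ∃ Λ, Λ = ∑ α ∈ Finset.Nat.antidiagonalTuple n (m + 1), L α := ⟨_, rfl⟩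
  rw [← hΛ]
  have hΛ0 : 0 ≤ Λ := hΛ ▸ Finset.sum_nonneg hL0
  have hLip : ∀ α : Fin n → ℕ, ∑ i, α i = m + 1 → LipBound β (DA α) Λ := by
    intro α hα x y
    have hα' := Finset.Nat.mem_antidiagonalTuple.2 hα
    refine (hL α hα' x y).trans ?_
    gcongr
    rw [hΛ]
    exact Finset.single_le_sum hL0 hα'
  obtain ⟨P, hP, hR1, hR2⟩ := good_points hβ0 hΛ0 A DA hA hDA hLip
  have hc : (0:ℝ) ≤ n ^ (m + 1) * Λ := by positivity
  have hDm : ∀ α : Fin n → ℕ, (∑ i, α i) ≤ m + 1 → AEStronglyMeasurable (DA α) volume :=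
    fun α hα => (hDA α hα).2.aestronglyMeasurable
  have hTA : TA (m + 1) A DA K f = fun x => ∫ y,
      (Rm (m + 2) A DA x y / ‖x - y‖ ^ (m + 1) * K x y) * f y := by
    ext x
    unfold TA
    simp only [mul_assoc]
  have hmain := H (n ^ (m + 1) * Λ * CK * E) (by positivity)
    (fun x y => Rm (m + 2) A DA x y / ‖x - y‖ ^ (m + 1) * K x y) P hP f hf
    (fun x => by
      have := ker_aesm A DA hDm K hKmeas f hf.1 x
      simp only [mul_assoc]
      exact this)
    (by
      have := TA_aesm A DA hA.aestronglyMeasurable hDm K hKmeas f hf.1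
      rw [hTA] at this
      exact this)
    (fun x y hx hy => by
      have h1 := kernel_size (m := m) (β := β) (δ := δ) (ν := n) (K := K x y) hβ0.le hc hCK
        (norm_nonneg (x - y)) (hR1 x y hx hy) (fun h => hK1 x y (by
          rintro rfl
          simp at h))
      refine h1.trans ?_
      have h2 : (0:ℝ) ≤ n ^ (m + 1) * Λ * CK := by positivity
      exact mul_le_mul_of_nonneg_right (le_mul_of_one_le_right h2 hE1) (by positivity))
    (fun x x0 y hx hx0 hy h2 hd => by
      have t1 : ‖x0 - y‖ = ‖y - x0‖ := norm_sub_rev _ _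
      have t2 : ‖x - y‖ ≤ ‖x - x0‖ + ‖y - x0‖ := by
        have := norm_sub_le (x - x0) (y - x0)
        simpa using this
      have t3 : ‖y - x0‖ ≤ ‖x - y‖ + ‖x - x0‖ := by
        have := norm_sub_le (x - x0) (x - y)
        simp only [_root_.sub_sub_sub_cancel_left] at this
        linarith
      have t4 := norm_nonneg (x - x0)
      have hxy : x ≠ y := by
        rintro rfl
        simp at t3
        linarith
      have r0 := hR1 x0 y hx0 hy
      rw [t1] at r0
      have r1 := hR2 x x0 y (2 * ‖y - x0‖) hx hx0 hy (by linarith) (by rw [t1]; linarith)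
      have h3 := kernel_real (ε := ε) (ν := n) hc hCK hδn hd t4 r1 r0 (hK1 x y hxy) (hK2 y x x0 h2)
        (by linarith) (by linarith) (abs_le.2 ⟨by linarith, by linarith⟩)
      rw [t1]
      rw [← hE] at h3
      exact h3)
    xt
  rw [hTA]
  refine hmain.trans ?_
  rw [show C * (n ^ (m + 1) * Λ * CK * E) = C * (n ^ (m + 1) * CK * E) * Λ by ring]
  gcongr
  exact le_self_add

end
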